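/- Let N be a positive integer and let ρ₁, ρ₂ : Fin N → Fin N → ℚ be two weight functions. Suppose that the celerity functions they induce on the Boolean hypercube agree, i.e. for every α : Fin N → Bool and every j : Fin N, ∑_{i with α i = true} ρ₁ i j − ∑_{i with α i = false} ρ₁ i j = ∑_{i with α i = true} ρ₂ i j − ∑_{i with α i = false} ρ₂ i j. Then ρ₁ = ρ₂. In other words, the influence graph inducing a given hybrid gene regulatory network is unique. -/

import Mathlib

/-- The celerity function on the Boolean hypercube induced by a weight function
`ρ : Fin N → Fin N → ℚ` (the influence graph): the celerity in direction `j`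
at discrete state `α` is the signed weighted sum over incoming edges. -/
def inducedCelerity {N : ℕ} (ρ : Fin N → Fin N → ℚ) (α : Fin N → Bool) (j : Fin N) : ℚ :=
  (∑ i ∈ Finset.univ.filter (fun i => α i = true), ρ i j) -
    (∑ i ∈ Finset.univ.filter (fun i => α i = false), ρ i j)

/-- The influence graph inducing a given hybrid gene regulatory network is unique:
if two weight functions induce the same celerity function on the Boolean hypercube,
then they are equal. -/
theorem influence_graph_unique (N : ℕ) (hN : 0 < N) (ρ₁ ρ₂ : Fin N → Fin N → ℚ)
    (h : ∀ (α : Fin N → Bool) (j : Fin N),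
      inducedCelerity ρ₁ α j = inducedCelerity ρ₂ α j) :
    ρ₁ = ρ₂ := by
  have key : ∀ (ρ : Fin N → Fin N → ℚ) (k j : Fin N),
      inducedCelerity ρ (fun i => decide (i = k)) j -
        inducedCelerity ρ (fun _ => false) j = 2 * ρ k j := by
    intro ρ k j
    have h1 := Finset.sum_filter_add_sum_filter_not Finset.univ (fun i => i = k)
      (fun i => ρ i j)
    have h2 : ∑ i ∈ Finset.univ.filter (fun i => i = k), ρ i j = ρ k j := by
      simp [Finset.filter_eq']
    simp only [inducedCelerity, decide_eq_true_eq, decide_eq_false_iff_not]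
    simp only [Bool.false_eq_true, Finset.filter_false, Finset.filter_true, Finset.sum_empty]
    linarith
  funext k j
  have h1 := key ρ₁ k j
  have h2 := key ρ₂ k j
  rw [h, h] at h1
  linarith
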